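/- arXiv:2409.14542 — 3 statements merged into one kernel-verified Lean document; each statement's English description precedes it below -/
import Mathlib

section
/- Let (Γ, d) be a metric space, Φ̂ ∈ Γ, ε ≥ 0, and let g : Γ → ℝ be a bounded Borel-measurable function. Then for every Borel probability measure Q on Γ with ∫ d(Φ, Φ̂) dQ(Φ) ≤ ε and every v ≥ 0: ∫ g dQ ≤ ε·v + sup_{Φ ∈ Γ} ( g(Φ) − v·d(Φ, Φ̂) ). -/
open MeasureTheory

theorem stmt14 (Γ : Type*) [MetricSpace Γ] [MeasurableSpace Γ] [BorelSpace Γ]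
    (Φhat : Γ) (ε : ℝ) (hε : 0 ≤ ε)
    (g : Γ → ℝ) (hgm : Measurable g) (C : ℝ) (hgb : ∀ x, |g x| ≤ C)
    (Q : Measure Γ) [IsProbabilityMeasure Q]
    (hQ : ∫⁻ x, ENNReal.ofReal (dist x Φhat) ∂Q ≤ ENNReal.ofReal ε)
    (v : ℝ) (hv : 0 ≤ v) :
    ∫ x, g x ∂Q ≤ ε * v + ⨆ x : Γ, (g x - v * dist x Φhat) := by
  have hdm : Measurable fun x : Γ => dist x Φhat :=
    (continuous_id.dist continuous_const).measurable
  have hd0 : ∀ᵐ x ∂Q, 0 ≤ dist x Φhat := .of_forall fun _ => dist_nonneg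
  have hdi : Integrable (fun x => dist x Φhat) Q := by
    refine ⟨hdm.aestronglyMeasurable, ?_⟩
    rw [hasFiniteIntegral_iff_ofReal hd0]
    exact hQ.trans_lt ENNReal.ofReal_lt_top
  have hgi : Integrable g Q :=
    .of_bound hgm.aestronglyMeasurable C (.of_forall hgb)
  have hdε : ∫ x, dist x Φhat ∂Q ≤ ε := by
    rw [integral_eq_lintegral_of_nonneg_ae hd0 hdm.aestronglyMeasurable]
    exact ENNReal.toReal_le_of_le_ofReal hε hQ
  have hbdd : BddAbove (Set.range fun x => g x - v * dist x Φhat) := by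
    refine ⟨C, ?_⟩
    rintro _ ⟨x, rfl⟩
    have h₁ := (abs_le.mp (hgb x)).2
    have h₂ := mul_nonneg hv (dist_nonneg (x := x) (y := Φhat))
    dsimp only
    linarith
  have hle : ∫ x, (g x - v * dist x Φhat) ∂Q ≤ ⨆ x : Γ, (g x - v * dist x Φhat) := by
    simpa using integral_mono (hgi.sub (hdi.const_mul v)) (integrable_const _)
      fun x => le_ciSup hbdd x
  rw [integral_sub hgi (hdi.const_mul v), integral_const_mul] at hle
  linarith [mul_le_mul_of_nonneg_left hdε hv]
end

section
/- Let (Γ, d) be a nonempty compact metric space, Φ̂ ∈ Γ, ε > 0, and let g : Γ → ℝ be continuous. Then sup { ∫ g dQ : Q a Borel probability measure on Γ with ∫ d(Φ, Φ̂) dQ(Φ) ≤ ε } = inf_{v ≥ 0} ( ε·v + sup_{Φ ∈ Γ} ( g(Φ) − v·d(Φ, Φ̂) ) ). -/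
open MeasureTheory

theorem exists_slope_of_two_point_bound {Γ : Type*} (g c : Γ → ℝ) (ε P : ℝ) {y₀ : Γ}
    (hy₀ : c y₀ < ε)
    (h : ∀ y z : Γ, ∀ t : ℝ, 0 ≤ t → t ≤ 1 → t * c y + (1 - t) * c z ≤ ε →
      t * g y + (1 - t) * g z ≤ P) :
    ∃ v : ℝ, 0 ≤ v ∧ ∀ y, g y - P ≤ v * (c y - ε) := by
  have hdirac : ∀ y, c y ≤ ε → g y ≤ P := fun y hy => by
    simpa using h y y 1 zero_le_one le_rfl (by simpa using hy)
  have hle : ∀ a ∈ insert 0 {x : ℝ | ∃ z, ε < c z ∧ x = (g z - P) / (c z - ε)},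
      ∀ b ∈ {x : ℝ | ∃ y, c y < ε ∧ x = (P - g y) / (ε - c y)}, a ≤ b := by
    rintro a (rfl | ⟨z, hz, rfl⟩) b ⟨y, hy, rfl⟩
    · exact div_nonneg (sub_nonneg.2 (hdirac y hy.le)) (sub_nonneg.2 hy.le)
    · have hpos : 0 < c z - c y := by linarith
      have key := h y z ((c z - ε) / (c z - c y))
        (div_nonneg (by linarith) hpos.le) ((div_le_one hpos).2 (by linarith))
        (le_of_eq (by field_simp; ring))
      have heq : (c z - ε) / (c z - c y) * g y + (1 - (c z - ε) / (c z - c y)) * g z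
          = ((c z - ε) * g y + (ε - c y) * g z) / (c z - c y) := by
        field_simp; ring
      rw [heq, div_le_iff₀ hpos] at key
      rw [div_le_div_iff₀ (by linarith) (by linarith)]
      linarith
  obtain ⟨v, hv, hv'⟩ := exists_between_of_forall_le (Set.insert_nonempty _ _)
    (by exact ⟨_, y₀, hy₀, rfl⟩) hle
  refine ⟨v, hv (Set.mem_insert _ _), fun y => ?_⟩
  rcases lt_trichotomy (c y) ε with hy | hy | hy
  · have := (le_div_iff₀ (sub_pos.2 hy)).1 (hv' ⟨y, hy, rfl⟩)
    linarith
  · have := hdirac y hy.le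
    simp [hy, this]
  · exact (div_le_iff₀ (sub_pos.2 hy)).1 (hv (Set.mem_insert_of_mem _ ⟨y, hy, rfl⟩))

theorem integral_le_of_le_add_mul {Γ : Type*} [MeasurableSpace Γ] {Q : Measure Γ}
    [IsProbabilityMeasure Q] {g c : Γ → ℝ} (hg : Integrable g Q) (hc : Integrable c Q)
    (hc0 : ∀ y, 0 ≤ c y) {ε v S : ℝ} (hε : 0 ≤ ε) (hv : 0 ≤ v)
    (hQ : ∫⁻ y, ENNReal.ofReal (c y) ∂Q ≤ ENNReal.ofReal ε) (h : ∀ y, g y ≤ S + v * c y) :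
    ∫ y, g y ∂Q ≤ ε * v + S := by
  have hcε : ∫ y, c y ∂Q ≤ ε := by
    rwa [← ofReal_integral_eq_lintegral_ofReal hc (.of_forall hc0),
      ENNReal.ofReal_le_ofReal_iff hε] at hQ
  calc ∫ y, g y ∂Q ≤ ∫ y, (S + v * c y) ∂Q :=
        integral_mono hg ((integrable_const S).add (hc.const_mul v)) h
    _ = S + v * ∫ y, c y ∂Q := by
        rw [integral_add (integrable_const S) (hc.const_mul v), integral_const_mul]
        simp
    _ ≤ ε * v + S := by nlinarith

theorem exists_two_point_measure {Γ : Type*} [MeasurableSpace Γ] [MeasurableSingletonClass Γ]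
    (g c : Γ → ℝ) (hc0 : ∀ y, 0 ≤ c y) (y z : Γ) {t ε : ℝ} (ht0 : 0 ≤ t) (ht1 : t ≤ 1)
    (h : t * c y + (1 - t) * c z ≤ ε) :
    ∃ Q : Measure Γ, IsProbabilityMeasure Q ∧
      (∫⁻ x, ENNReal.ofReal (c x) ∂Q) ≤ ENNReal.ofReal ε ∧
      t * g y + (1 - t) * g z = ∫ x, g x ∂Q := by
  have ht1' : 0 ≤ 1 - t := sub_nonneg.2 ht1
  refine ⟨ENNReal.ofReal t • Measure.dirac y + ENNReal.ofReal (1 - t) • Measure.dirac z,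
    ⟨?_⟩, ?_, ?_⟩
  · simp [← ENNReal.ofReal_add ht0 ht1']
  · rw [lintegral_add_measure, lintegral_smul_measure, lintegral_smul_measure,
      lintegral_dirac, lintegral_dirac, smul_eq_mul, smul_eq_mul, ← ENNReal.ofReal_mul ht0,
      ← ENNReal.ofReal_mul ht1', ← ENNReal.ofReal_add (mul_nonneg ht0 (hc0 y))
        (mul_nonneg ht1' (hc0 z))]
    exact ENNReal.ofReal_le_ofReal h
  · have hint : ∀ x, Integrable g (Measure.dirac x) := fun x => integrable_dirac (by simp)
    rw [integral_add_measure ((hint y).smul_measure ENNReal.ofReal_ne_top)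
      ((hint z).smul_measure ENNReal.ofReal_ne_top)]
    simp [integral_smul_measure, ht0, ht1]

theorem stmt15 (Γ : Type*) [MetricSpace Γ] [CompactSpace Γ] [Nonempty Γ]
    [MeasurableSpace Γ] [BorelSpace Γ]
    (Φhat : Γ) (ε : ℝ) (hε : 0 < ε) (g : Γ → ℝ) (hg : Continuous g) :
    sSup {x : ℝ | ∃ Q : Measure Γ, IsProbabilityMeasure Q ∧
        (∫⁻ y, ENNReal.ofReal (dist y Φhat) ∂Q) ≤ ENNReal.ofReal ε ∧
        x = ∫ y, g y ∂Q}
      = sInf {x : ℝ | ∃ v : ℝ, 0 ≤ v ∧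
          x = ε * v + ⨆ y : Γ, (g y - v * dist y Φhat)} := by
  have hdist : Continuous fun y : Γ => dist y Φhat := by fun_prop
  set A := {x : ℝ | ∃ Q : Measure Γ, IsProbabilityMeasure Q ∧
        (∫⁻ y, ENNReal.ofReal (dist y Φhat) ∂Q) ≤ ENNReal.ofReal ε ∧
        x = ∫ y, g y ∂Q}
  set B := {x : ℝ | ∃ v : ℝ, 0 ≤ v ∧
          x = ε * v + ⨆ y : Γ, (g y - v * dist y Φhat)}
  have hweak : ∀ a ∈ A, ∀ b ∈ B, a ≤ b := by
    rintro a ⟨Q, hQ, hQε, rfl⟩ b ⟨v, hv, rfl⟩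
    have hbdd : BddAbove (Set.range fun y : Γ => g y - v * dist y Φhat) :=
      (isCompact_range (by fun_prop)).bddAbove
    refine integral_le_of_le_add_mul
      (hg.integrable_of_hasCompactSupport (.of_compactSpace g))
      (hdist.integrable_of_hasCompactSupport (.of_compactSpace _))
      (fun _ => dist_nonneg) hε.le hv hQε fun y => ?_
    have := le_ciSup hbdd y
    linarith
  have hmix : ∀ y z : Γ, ∀ t : ℝ, 0 ≤ t → t ≤ 1 →
      t * dist y Φhat + (1 - t) * dist z Φhat ≤ ε → t * g y + (1 - t) * g z ∈ A :=
    fun y z t ht0 ht1 h =>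
      exists_two_point_measure g (dist · Φhat) (fun _ => dist_nonneg) y z ht0 ht1 h
  have hAne : A.Nonempty := ⟨_, hmix Φhat Φhat 1 zero_le_one le_rfl (by simpa using hε.le)⟩
  have hBne : B.Nonempty := ⟨_, 0, le_rfl, rfl⟩
  have hAbdd : BddAbove A := hBne.imp fun b hb a ha => hweak a ha b hb
  have hBbdd : BddBelow B := hAne.imp fun a ha b hb => hweak a ha b hb
  refine le_antisymm
    (csSup_le hAne fun a ha => le_csInf hBne fun b hb => hweak a ha b hb) ?_
  obtain ⟨v, hv, hvy⟩ := exists_slope_of_two_point_bound g (dist · Φhat) ε (sSup A)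
    (y₀ := Φhat) (by simpa using hε)
    fun y z t ht0 ht1 h => le_csSup hAbdd (hmix y z t ht0 ht1 h)
  refine (csInf_le hBbdd ⟨v, hv, rfl⟩).trans ?_
  have : ⨆ y : Γ, (g y - v * dist y Φhat) ≤ sSup A - ε * v :=
    ciSup_le fun y => by linarith [hvy y]
  linarith
end

section
/- Let (Γ, d) be a nonempty compact metric space, Φ̂ ∈ Γ, ε > 0, let Ψ be a nonempty set, and let h : Ψ × Γ → ℝ be such that h(ψ, ·) is continuous on Γ for each ψ ∈ Ψ. Then inf_{ψ ∈ Ψ} sup { ∫ h(ψ, Φ) dQ(Φ) : Q a Borel probability measure on Γ with ∫ d(Φ, Φ̂) dQ(Φ) ≤ ε } = inf { ε·v₂ + v₁ : ψ ∈ Ψ, v₂ ≥ 0, v₁ ∈ ℝ, and h(ψ, Φ) − v₂·d(Φ, Φ̂) − v₁ ≤ 0 for all Φ ∈ Γ }. -/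
open MeasureTheory

section MomentDuality

variable {Γ : Type*} [MetricSpace Γ] [MeasurableSpace Γ]

/-- The values `∫ f dQ` over probability measures `Q` with first moment about `p` at most `ε`. -/
def momentValues (p : Γ) (ε : ℝ) (f : Γ → ℝ) : Set ℝ :=
  {x : ℝ | ∃ Q : Measure Γ, IsProbabilityMeasure Q ∧
    (∫⁻ y, ENNReal.ofReal (dist y p) ∂Q) ≤ ENNReal.ofReal ε ∧ x = ∫ y, f y ∂Q}

/-- The objective values of the dual semi-infinite program. -/
def dualValues (p : Γ) (ε : ℝ) (f : Γ → ℝ) : Set ℝ :=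
  {x : ℝ | ∃ v1 v2 : ℝ, 0 ≤ v2 ∧ (∀ y : Γ, f y - v2 * dist y p - v1 ≤ 0) ∧ x = ε * v2 + v1}

variable [BorelSpace Γ]

lemma convexCombination_mem_momentValues {p y z : Γ} {ε a b : ℝ} (f : Γ → ℝ)
    (ha : 0 ≤ a) (hb : 0 ≤ b) (hab : a + b = 1) (hd : a * dist y p + b * dist z p ≤ ε) :
    a * f y + b * f z ∈ momentValues p ε f := by
  refine ⟨ENNReal.ofReal a • Measure.dirac y + ENNReal.ofReal b • Measure.dirac z, ⟨?_⟩, ?_, ?_⟩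
  · simp [← ENNReal.ofReal_add ha hb, hab]
  · rw [lintegral_add_measure, lintegral_smul_measure, lintegral_smul_measure, lintegral_dirac,
      lintegral_dirac, smul_eq_mul, smul_eq_mul, ← ENNReal.ofReal_mul ha, ← ENNReal.ofReal_mul hb,
      ← ENNReal.ofReal_add (by positivity) (by positivity)]
    exact ENNReal.ofReal_le_ofReal hd
  · have hint (w : Γ) : Integrable f (Measure.dirac w) := integrable_dirac (by simp)
    rw [integral_add_measure ((hint y).smul_measure ENNReal.ofReal_ne_top)
      ((hint z).smul_measure ENNReal.ofReal_ne_top), integral_smul_measure, integral_smul_measure,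
      integral_dirac, integral_dirac, ENNReal.toReal_ofReal ha, ENNReal.toReal_ofReal hb,
      smul_eq_mul, smul_eq_mul]

lemma apply_mem_momentValues {p y : Γ} {ε : ℝ} (f : Γ → ℝ) (hd : dist y p ≤ ε) :
    f y ∈ momentValues p ε f := by
  simpa using convexCombination_mem_momentValues (y := y) (z := y) f zero_le_one le_rfl
    (add_zero 1) (by simpa using hd)

variable [CompactSpace Γ]

lemma le_of_mem_momentValues_of_mem_dualValues {p : Γ} {ε : ℝ} {f : Γ → ℝ} (hε : 0 ≤ ε)
    (hf : Continuous f) {x v : ℝ} (hx : x ∈ momentValues p ε f) (hv : v ∈ dualValues p ε f) :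
    x ≤ v := by
  obtain ⟨Q, hQ, hd, rfl⟩ := hx
  obtain ⟨v1, v2, hv2, hle, rfl⟩ := hv
  have hdc : Continuous fun y : Γ => dist y p := by fun_prop
  have hint {g : Γ → ℝ} (hg : Continuous g) : Integrable g Q :=
    hg.integrable_of_hasCompactSupport (HasCompactSupport.of_compactSpace g)
  have hmoment : ∫ y, dist y p ∂Q ≤ ε := by
    rw [integral_eq_lintegral_of_nonneg_ae (ae_of_all _ fun _ => dist_nonneg)
      hdc.aestronglyMeasurable]
    exact ENNReal.toReal_le_of_le_ofReal hε hd
  calc ∫ y, f y ∂Q ≤ ∫ y, (v2 * dist y p + v1) ∂Q :=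
        integral_mono (hint hf) (hint (by fun_prop)) fun y => by linarith [hle y]
    _ = v2 * ∫ y, dist y p ∂Q + v1 := by
        rw [integral_add (hint (by fun_prop)) (integrable_const _), integral_const_mul]
        simp
    _ ≤ ε * v2 + v1 := by nlinarith

lemma bddAbove_momentValues {p : Γ} {ε : ℝ} {f : Γ → ℝ} (hε : 0 ≤ ε) (hf : Continuous f) :
    BddAbove (momentValues p ε f) := by
  obtain ⟨M, hM⟩ := (isCompact_range hf).bddAbove
  refine ⟨ε * 0 + M, fun x hx => le_of_mem_momentValues_of_mem_dualValues hε hf hx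
    ⟨M, 0, le_rfl, fun y => ?_, rfl⟩⟩
  linarith [hM ⟨y, rfl⟩]

/-- Strong duality, with attainment on the dual side. -/
lemma isLeast_dualValues {p : Γ} {ε : ℝ} {f : Γ → ℝ} (hε : 0 < ε) (hf : Continuous f) :
    IsLeast (dualValues p ε f) (sSup (momentValues p ε f)) := by
  have hbdd := bddAbove_momentValues (p := p) hε.le hf
  have hp : f p ∈ momentValues p ε f := apply_mem_momentValues f (by simpa using hε.le)
  refine ⟨?_, fun v hv => csSup_le ⟨_, hp⟩ fun x hx =>
    le_of_mem_momentValues_of_mem_dualValues hε.le hf hx hv⟩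
  set S := sSup (momentValues p ε f)
  have hS {y : Γ} (hy : dist y p ≤ ε) : f y ≤ S := le_csSup hbdd (apply_mem_momentValues f hy)
  obtain ⟨m, hm_upper, hm_lower⟩ := exists_between_of_forall_le
    (s := insert 0 ((fun y => (f y - S) / (dist y p - ε)) '' {y | ε < dist y p}))
    (t := (fun y => (S - f y) / (ε - dist y p)) '' {y | dist y p < ε})
    ⟨0, Set.mem_insert _ _⟩ ⟨_, p, by simpa using hε, rfl⟩ (by
      rintro _ (rfl | ⟨y, hy, rfl⟩) _ ⟨z, hz, rfl⟩ <;> simp only [Set.mem_ofPred_eq] at *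
      · exact div_nonneg (sub_nonneg.2 (hS hz.le)) (sub_nonneg.2 hz.le)
      · have hyz : 0 < dist y p - dist z p := by linarith
        have hmix := le_csSup hbdd (convexCombination_mem_momentValues (p := p) (y := y) (z := z)
          (ε := ε) (a := (ε - dist z p) / (dist y p - dist z p))
          (b := (dist y p - ε) / (dist y p - dist z p)) f
          (div_nonneg (by linarith) hyz.le) (div_nonneg (by linarith) hyz.le)
          (by field_simp; ring) (le_of_eq (by field_simp; ring)))
        change _ ≤ S at hmix
        rw [div_mul_eq_mul_div, div_mul_eq_mul_div, ← add_div, div_le_iff₀ hyz] at hmix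
        rw [div_le_div_iff₀ (by linarith) (by linarith)]
        linarith)
  refine ⟨S - ε * m, m, hm_upper (Set.mem_insert _ _), fun y => ?_, by ring⟩
  rcases lt_trichotomy (dist y p) ε with hy | hy | hy
  · have := hm_lower ⟨y, hy, rfl⟩
    rw [le_div_iff₀ (by linarith)] at this
    linarith
  · have := hS hy.le
    rw [hy]
    linarith
  · have := hm_upper (Set.mem_insert_of_mem _ ⟨y, hy, rfl⟩)
    rw [div_le_iff₀ (by linarith)] at this
    linarith

end MomentDuality

/-- No boundedness is needed: both sides are `0` when the family is unbounded below. -/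
lemma Real.iInf_eq_sInf_iUnion_of_isLeast {ι : Type*} [Nonempty ι] {F : ι → Set ℝ} {s : ι → ℝ}
    (hs : ∀ i, IsLeast (F i) (s i)) : ⨅ i, s i = sInf (⋃ i, F i) := by
  have hsub : Set.range s ⊆ ⋃ i, F i := by
    rintro _ ⟨i, rfl⟩
    exact Set.mem_iUnion.2 ⟨i, (hs i).1⟩
  have hlower : lowerBounds (Set.range s) = lowerBounds (⋃ i, F i) := by
    refine Set.Subset.antisymm (fun c hc x hx => ?_) (lowerBounds_mono_set hsub)
    obtain ⟨i, hi⟩ := Set.mem_iUnion.1 hx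
    exact (hc ⟨i, rfl⟩).trans ((hs i).2 hi)
  by_cases hb : BddBelow (Set.range s)
  · have hglb : IsGLB (⋃ i, F i) (⨅ i, s i) := by
      rw [IsGLB, ← hlower]
      exact isGLB_ciInf hb
    exact (hglb.csInf_eq ((Set.range_nonempty s).mono hsub)).symm
  · rw [Real.iInf_of_not_bddBelow hb,
      Real.sInf_of_not_bddBelow fun h => hb (h.mono hsub)]

theorem stmt16 (Γ : Type*) [MetricSpace Γ] [CompactSpace Γ] [Nonempty Γ]
    [MeasurableSpace Γ] [BorelSpace Γ]
    (Ψ : Type*) [Nonempty Ψ]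
    (Φhat : Γ) (ε : ℝ) (hε : 0 < ε)
    (h : Ψ → Γ → ℝ) (hcont : ∀ ψ, Continuous (h ψ)) :
    (⨅ ψ : Ψ, sSup {x : ℝ | ∃ Q : Measure Γ, IsProbabilityMeasure Q ∧
        (∫⁻ y, ENNReal.ofReal (dist y Φhat) ∂Q) ≤ ENNReal.ofReal ε ∧
        x = ∫ y, h ψ y ∂Q})
      = sInf {x : ℝ | ∃ ψ : Ψ, ∃ v1 v2 : ℝ, 0 ≤ v2 ∧
          (∀ Φ : Γ, h ψ Φ - v2 * dist Φ Φhat - v1 ≤ 0) ∧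
          x = ε * v2 + v1} := by
  have key := Real.iInf_eq_sInf_iUnion_of_isLeast fun ψ =>
    isLeast_dualValues (p := Φhat) hε (hcont ψ)
  simpa only [momentValues, dualValues, ← Set.ofPred_exists] using key
end
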